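/- Let B ≥ 0 and suppose |a_n| ≤ B for all n ≥ 0 and |b_n| ≤ B for all n ≥ 1. Let z ∈ ℂ with 0 < |z| < 1/(3B+1) and set λ = z + 1/z. Then for each n ≥ 0 the series û_n := -Σ_{t=0}^∞ z^t u^δ(n,t) converges absolutely; moreover û_0 = -1, Σ_{n=1}^∞ |û_n|² < ∞, and a_{n-1}û_{n-1} + b_nû_n + a_nû_{n+1} = λ·û_n for all n ≥ 1. -/

import Mathlib

/-- The control δ: δ(0)=1, δ(t)=0 for t ≥ 1. -/
noncomputable def deltaCtrl : ℕ → ℂ := fun t => if t = 0 then 1 else 0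

/-- `IsSol a b f u` : `u` is the solution of the semi-infinite discrete dynamical
system with coefficients `a`, `b` and boundary control `f`. -/
def IsSol (a b : ℕ → ℂ) (f : ℕ → ℂ) (u : ℕ → ℤ → ℂ) : Prop :=
  (∀ n : ℕ, 1 ≤ n → ∀ t : ℤ, t ≤ 0 → u n t = 0) ∧
  (∀ t : ℕ, u 0 (t : ℤ) = f t) ∧
  (∀ t : ℤ, t < 0 → u 0 t = 0) ∧
  (∀ n : ℕ, 1 ≤ n → ∀ t : ℕ,
    u n ((t : ℤ) + 1) + u n ((t : ℤ) - 1) - a n * u (n + 1) (t : ℤ)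
      - a (n - 1) * u (n - 1) (t : ℤ) - b n * u n (t : ℤ) = 0)

lemma IsSol.eq_zero_of_lt {a b f : ℕ → ℂ} {u : ℕ → ℤ → ℂ} (hu : IsSol a b f u) :
    ∀ t n : ℕ, t < n → u n (t : ℤ) = 0
  | 0, n, h => hu.1 n h _ le_rfl
  | 1, n, h => by
    obtain ⟨h0, -, -, hrec⟩ := hu
    have h1 := hrec n (by omega) 0
    simpa [h0 n (by omega), h0 (n + 1) (by omega), h0 (n - 1) (by omega)] using h1
  | t + 2, n, h => by
    have h1 := hu.2.2.2 n (by omega) (t + 1)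
    rw [show (((t + 1 : ℕ) : ℤ) - 1) = (t : ℤ) by push_cast; ring,
      hu.eq_zero_of_lt t n (by omega), hu.eq_zero_of_lt (t + 1) n (by omega),
      hu.eq_zero_of_lt (t + 1) (n + 1) (by omega),
      hu.eq_zero_of_lt (t + 1) (n - 1) (by omega)] at h1
    simpa [add_assoc, one_add_one_eq_two] using h1

lemma IsSol.norm_add_one_le {a b f : ℕ → ℂ} {u : ℕ → ℤ → ℂ} (hu : IsSol a b f u) {B C D : ℝ}
    (ha : ∀ n, ‖a n‖ ≤ B) (hb : ∀ n, 1 ≤ n → ‖b n‖ ≤ B) {t : ℕ}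
    (hC : ∀ n, ‖u n (t : ℤ)‖ ≤ C) (hD : ∀ n, 1 ≤ n → ‖u n ((t : ℤ) - 1)‖ ≤ D)
    {n : ℕ} (hn : 1 ≤ n) : ‖u n ((t : ℤ) + 1)‖ ≤ 3 * B * C + D := by
  have hB : 0 ≤ B := (norm_nonneg _).trans (ha 0)
  have h : u n ((t : ℤ) + 1) = a n * u (n + 1) (t : ℤ) + a (n - 1) * u (n - 1) (t : ℤ)
      + b n * u n (t : ℤ) - u n ((t : ℤ) - 1) := by
    linear_combination hu.2.2.2 n hn t
  have hmul {x y : ℂ} (hx : ‖x‖ ≤ B) (hy : ‖y‖ ≤ C) : ‖x * y‖ ≤ B * C := by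
    rw [norm_mul]
    gcongr
  calc ‖u n ((t : ℤ) + 1)‖
      ≤ ‖a n * u (n + 1) (t : ℤ)‖ + ‖a (n - 1) * u (n - 1) (t : ℤ)‖
        + ‖b n * u n (t : ℤ)‖ + ‖u n ((t : ℤ) - 1)‖ := by
        rw [h]
        exact (norm_sub_le _ _).trans (by gcongr; exact norm_add₃_le)
    _ ≤ B * C + B * C + B * C + D :=
        add_le_add (add_le_add (add_le_add (hmul (ha _) (hC _)) (hmul (ha _) (hC _)))
          (hmul (hb n hn) (hC _))) (hD n hn)
    _ = 3 * B * C + D := by ring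

lemma IsSol.norm_le_pow {a b : ℕ → ℂ} {u : ℕ → ℤ → ℂ} (hu : IsSol a b deltaCtrl u) {B : ℝ}
    (ha : ∀ n, ‖a n‖ ≤ B) (hb : ∀ n, 1 ≤ n → ‖b n‖ ≤ B) :
    ∀ t n : ℕ, ‖u n (t : ℤ)‖ ≤ (3 * B + 1) ^ t
  | 0, n => by
    rcases Nat.eq_zero_or_pos n with rfl | hn
    · rw [hu.2.1]
      simp [deltaCtrl]
    · rw [hu.eq_zero_of_lt 0 n hn]
      simp
  | t + 1, 0 => by
    have hB : 0 ≤ B := (norm_nonneg _).trans (ha 0)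
    simp only [hu.2.1, deltaCtrl, Nat.add_eq_zero_iff, one_ne_zero, and_false, if_false, norm_zero]
    positivity
  | 1, n + 1 => by
    have h := hu.norm_add_one_le ha hb (t := 0) (C := 1) (D := 0)
      (fun m => by simpa using hu.norm_le_pow ha hb 0 m)
      (fun m hm => by simp [hu.1 m hm]) (n := n + 1) (by omega)
    simp only [Nat.cast_zero, zero_add] at h
    simp only [Nat.cast_one, pow_one]
    linarith
  | t + 2, n + 1 => by
    have hB : 0 ≤ B := (norm_nonneg _).trans (ha 0)
    have h := hu.norm_add_one_le ha hb (t := t + 1) (D := (3 * B + 1) ^ t)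
      (fun m => hu.norm_le_pow ha hb (t + 1) m)
      (fun m _ => by simpa using hu.norm_le_pow ha hb t m) (n := n + 1) (by omega)
    have hpow : (3 * B + 1) ^ t ≤ (3 * B + 1) ^ (t + 1) :=
      pow_le_pow_right₀ (by linarith) (Nat.le_succ t)
    calc ‖u (n + 1) ((t + 2 : ℕ) : ℤ)‖ = ‖u (n + 1) (((t + 1 : ℕ) : ℤ) + 1)‖ := by
          push_cast
          ring_nf
      _ ≤ _ := h
      _ ≤ 3 * B * (3 * B + 1) ^ (t + 1) + (3 * B + 1) ^ (t + 1) := by gcongr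
      _ = (3 * B + 1) ^ (t + 2) := by ring

lemma IsSol.norm_pow_mul_le {a b : ℕ → ℂ} {u : ℕ → ℤ → ℂ} (hu : IsSol a b deltaCtrl u) {B : ℝ}
    (ha : ∀ n, ‖a n‖ ≤ B) (hb : ∀ n, 1 ≤ n → ‖b n‖ ≤ B) (z : ℂ) (n t : ℕ) :
    ‖z ^ t * u n (t : ℤ)‖ ≤ (‖z‖ * (3 * B + 1)) ^ t := by
  rw [norm_mul, norm_pow, mul_pow]
  gcongr
  exact hu.norm_le_pow ha hb t n

lemma IsSol.norm_tsum_le {a b : ℕ → ℂ} {u : ℕ → ℤ → ℂ} (hu : IsSol a b deltaCtrl u) {B : ℝ}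
    (ha : ∀ n, ‖a n‖ ≤ B) (hb : ∀ n, 1 ≤ n → ‖b n‖ ≤ B) {z : ℂ}
    (hz : ‖z‖ * (3 * B + 1) < 1) (n : ℕ) :
    ‖∑' t : ℕ, z ^ t * u n (t : ℤ)‖ ≤
      (‖z‖ * (3 * B + 1)) ^ n * (1 - ‖z‖ * (3 * B + 1))⁻¹ := by
  have hB : 0 ≤ B := (norm_nonneg _).trans (ha 0)
  have hq : 0 ≤ ‖z‖ * (3 * B + 1) := by positivity
  have hs : Summable fun t : ℕ => z ^ t * u n (t : ℤ) :=
    .of_norm_bounded (summable_geometric_of_lt_one hq hz) (hu.norm_pow_mul_le ha hb z n)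
  rw [← hs.sum_add_tsum_nat_add n, Finset.sum_eq_zero fun t ht => by
    rw [hu.eq_zero_of_lt t n (Finset.mem_range.1 ht), mul_zero], zero_add]
  refine tsum_of_norm_bounded ((hasSum_geometric_of_lt_one hq hz).mul_left _) fun t => ?_
  rw [← pow_add, add_comm n t]
  exact hu.norm_pow_mul_le ha hb z n (t + n)

lemma IsSol.tsum_recurrence {a b f : ℕ → ℂ} {u : ℕ → ℤ → ℂ} (hu : IsSol a b f u) {z : ℂ}
    (hz : z ≠ 0) (hs : ∀ n, Summable fun t : ℕ => z ^ t * u n (t : ℤ)) {n : ℕ} (hn : 1 ≤ n) :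
    a (n - 1) * ∑' t : ℕ, z ^ t * u (n - 1) (t : ℤ) + b n * ∑' t : ℕ, z ^ t * u n (t : ℤ)
      + a n * ∑' t : ℕ, z ^ t * u (n + 1) (t : ℤ)
      = (z + 1 / z) * ∑' t : ℕ, z ^ t * u n (t : ℤ) := by
  have hnext : HasSum (fun t : ℕ => z ^ t * u n ((t : ℤ) + 1))
      (z⁻¹ * ∑' t : ℕ, z ^ t * u n (t : ℤ)) := by
    have h := ((hasSum_nat_add_iff' 1).2 (hs n).hasSum).mul_left z⁻¹
    simp only [Finset.sum_range_one, Nat.cast_zero, hu.1 n hn 0 le_rfl, mul_zero, sub_zero] at h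
    refine h.congr_fun fun t => ?_
    push_cast
    field_simp
    ring
  have hprev : HasSum (fun t : ℕ => z ^ t * u n ((t : ℤ) - 1))
      (z * ∑' t : ℕ, z ^ t * u n (t : ℤ)) := by
    rw [← hasSum_nat_add_iff' 1]
    simp only [Finset.sum_range_one, Nat.cast_zero, hu.1 n hn (0 - 1) (by norm_num), mul_zero,
      sub_zero]
    refine ((hs n).hasSum.mul_left z).congr_fun fun t => ?_
    push_cast
    rw [add_sub_cancel_right]
    ring
  have hsum := (((hs (n - 1)).hasSum.mul_left (a (n - 1))).add ((hs n).hasSum.mul_left (b n))).add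
    ((hs (n + 1)).hasSum.mul_left (a n))
  rw [add_comm z, one_div, add_mul]
  refine hsum.unique ((hnext.add hprev).congr_fun fun t => ?_)
  linear_combination -z ^ t * hu.2.2.2 n hn t

theorem fourier_transform_of_solution_semiinfinite
    (a b : ℕ → ℂ) (B : ℝ) (hB : 0 ≤ B)
    (haB : ∀ n : ℕ, ‖a n‖ ≤ B) (hbB : ∀ n : ℕ, 1 ≤ n → ‖b n‖ ≤ B)
    (u : ℕ → ℤ → ℂ) (hu : IsSol a b deltaCtrl u)
    (z : ℂ) (hz0 : 0 < ‖z‖) (hz1 : ‖z‖ < 1 / (3 * B + 1))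
    (lam : ℂ) (hlam : lam = z + 1 / z) :
    (∀ n : ℕ, Summable (fun t : ℕ => ‖z ^ t * u n (t : ℤ)‖)) ∧
    (let uhat : ℕ → ℂ := fun n => -∑' t : ℕ, z ^ t * u n (t : ℤ)
     uhat 0 = -1 ∧
     Summable (fun n : ℕ => ‖uhat (n + 1)‖ ^ 2) ∧
     ∀ n : ℕ, 1 ≤ n →
       a (n - 1) * uhat (n - 1) + b n * uhat n + a n * uhat (n + 1) = lam * uhat n) := by
  have hq : ‖z‖ * (3 * B + 1) < 1 := (lt_div_iff₀ (by positivity)).1 hz1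
  have hq0 : 0 ≤ ‖z‖ * (3 * B + 1) := by positivity
  have hs (n : ℕ) : Summable fun t : ℕ => ‖z ^ t * u n (t : ℤ)‖ :=
    .of_nonneg_of_le (fun _ => norm_nonneg _) (hu.norm_pow_mul_le haB hbB z n)
      (summable_geometric_of_lt_one hq0 hq)
  refine ⟨hs, ?_, ?_, fun n hn => ?_⟩
  · simp only [hu.2.1, deltaCtrl]
    rw [tsum_eq_single 0 fun t ht => by simp [ht]]
    simp
  · have hgeom := (summable_geometric_of_lt_one (sq_nonneg (‖z‖ * (3 * B + 1)))
      (pow_lt_one₀ hq0 hq two_ne_zero)).mul_right ((1 - ‖z‖ * (3 * B + 1))⁻¹ ^ 2)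
    refine .of_nonneg_of_le (fun _ => sq_nonneg _) (fun n => ?_) ((summable_nat_add_iff 1).2 hgeom)
    rw [norm_neg, pow_right_comm, ← mul_pow]
    gcongr
    exact hu.norm_tsum_le haB hbB hq (n + 1)
  · have h := hu.tsum_recurrence (norm_pos_iff.1 hz0) (fun m => (hs m).of_norm) hn
    rw [hlam]
    linear_combination -h
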